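/- arXiv:2205.08940 — 2 statements merged into one kernel-verified Lean document; each statement's English description precedes it below -/
import Mathlib

section
/- Let Ω be a state space and ω, σ ∈ Ω. Then F(ω, σ) = 0 if and only if ω and σ are perfectly distinguishable, i.e., there exists an effect e on Ω with e(ω) = 1 and e(σ) = 0. -/
open scoped BigOperators

/-- A state space: a compact convex subset `Ω` of a finite-dimensional real vector space `V`
which spans `V` and whose affine hull does not contain the origin. -/
def IsStateSpace {V : Type*} [NormedAddCommGroup V] [NormedSpace ℝ V] (Ω : Set V) : Prop :=
  IsCompact Ω ∧ Convex ℝ Ω ∧ Submodule.span ℝ Ω = ⊤ ∧ (0 : V) ∉ (affineSpan ℝ Ω : Set V)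

/-- An effect on `Ω`: a linear functional taking values in `[0,1]` on `Ω`. -/
def IsEffect {V : Type*} [AddCommGroup V] [Module ℝ V] (Ω : Set V) (e : V →ₗ[ℝ] ℝ) : Prop :=
  ∀ ω ∈ Ω, e ω ∈ Set.Icc (0 : ℝ) 1

/-- The unit effect on `Ω`: the linear functional equal to `1` on `Ω`. -/
def IsUnitEffect {V : Type*} [AddCommGroup V] [Module ℝ V] (Ω : Set V)
    (u : V →ₗ[ℝ] ℝ) : Prop :=
  ∀ ω ∈ Ω, u ω = 1

/-- An observable on `Ω`: a finite family of effects summing to the unit effect. -/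
def IsObservable {V : Type*} [AddCommGroup V] [Module ℝ V] (Ω : Set V) {X : Type*} [Fintype X]
    (e : X → (V →ₗ[ℝ] ℝ)) : Prop :=
  (∀ x, IsEffect Ω (e x)) ∧ ∀ ω ∈ Ω, ∑ x, e x ω = 1

/-- The fidelity of two states `ω, σ ∈ Ω`: the infimum over all observables `{e_x}` on `Ω`
of `∑ x, √(e_x ω) · √(e_x σ)`. -/
noncomputable def fidelity {V : Type*} [AddCommGroup V] [Module ℝ V] (Ω : Set V)
    (ω σ : V) : ℝ :=
  sInf { r | ∃ (nn : ℕ) (e : Fin nn → (V →ₗ[ℝ] ℝ)), IsObservable Ω e ∧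
    r = ∑ x, Real.sqrt (e x ω) * Real.sqrt (e x σ) }

section Effects

variable {V : Type*} [AddCommGroup V] [Module ℝ V] {Ω : Set V}

/-- A unit effect exists as soon as the affine span of `Ω` misses the origin. -/
lemma exists_isUnitEffect (h0 : (0 : V) ∉ (affineSpan ℝ Ω : Set V)) {p : V} (hp : p ∈ Ω) :
    ∃ u : V →ₗ[ℝ] ℝ, IsUnitEffect Ω u := by
  have hp' : p ∈ affineSpan ℝ Ω := subset_affineSpan ℝ Ω hp
  have hpd : p ∉ (affineSpan ℝ Ω).direction := fun h => h0 (by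
    simpa using AffineSubspace.vadd_mem_of_mem_direction (neg_mem h) hp')
  obtain ⟨f, hfp, hf⟩ := Submodule.exists_le_ker_of_notMem hpd
  refine ⟨(f p)⁻¹ • f, fun w hw => ?_⟩
  have h : f (w - p) = 0 :=
    hf (AffineSubspace.vsub_mem_direction (subset_affineSpan ℝ Ω hw) hp')
  have h' : f w = f p := by simpa [sub_eq_zero] using h
  simp [h', hfp]

/-- The sum of some of the members of an observable is an effect. -/
lemma IsObservable.isEffect_sum {X : Type*} [Fintype X] {e : X → (V →ₗ[ℝ] ℝ)}
    (he : IsObservable Ω e) (s : Finset X) : IsEffect Ω (∑ x ∈ s, e x) := by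
  intro w hw
  rw [LinearMap.sum_apply]
  refine ⟨Finset.sum_nonneg fun x _ => (he.1 x w hw).1, ?_⟩
  rw [← he.2 w hw]
  exact Finset.sum_le_univ_sum_of_nonneg fun x => (he.1 x w hw).1

/-- Coarse-graining an observable by maximum likelihood gives an effect whose discrimination
error is bounded by the classical fidelity of the outcome distributions. -/
lemma IsObservable.exists_isEffect_error_le {X : Type*} [Fintype X] {e : X → (V →ₗ[ℝ] ℝ)}
    (he : IsObservable Ω e) {ω σ : V} (hω : ω ∈ Ω) (hσ : σ ∈ Ω) :
    ∃ a : V →ₗ[ℝ] ℝ, IsEffect Ω a ∧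
      a σ + (1 - a ω) ≤ ∑ x, Real.sqrt (e x ω) * Real.sqrt (e x σ) := by
  classical
  refine ⟨∑ x with e x σ ≤ e x ω, e x, he.isEffect_sum _, ?_⟩
  have hsplit := Finset.sum_filter_add_sum_filter_not Finset.univ
    (fun x => e x σ ≤ e x ω) (fun x => e x ω)
  rw [LinearMap.sum_apply, LinearMap.sum_apply, ← he.2 ω hω, ← hsplit, add_sub_cancel_left,
    ← Finset.sum_filter_add_sum_filter_not Finset.univ (fun x => e x σ ≤ e x ω)
      (fun x => Real.sqrt (e x ω) * Real.sqrt (e x σ))]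
  refine add_le_add (Finset.sum_le_sum fun x hx => ?_) (Finset.sum_le_sum fun x hx => ?_)
  · have hx : e x σ ≤ e x ω := by simpa using hx
    calc e x σ = Real.sqrt (e x σ) * Real.sqrt (e x σ) :=
          (Real.mul_self_sqrt (he.1 x σ hσ).1).symm
      _ ≤ _ := by gcongr
  · have hx : e x ω ≤ e x σ := (not_le.1 (Finset.mem_filter.1 hx).2).le
    calc e x ω = Real.sqrt (e x ω) * Real.sqrt (e x ω) :=
          (Real.mul_self_sqrt (he.1 x ω hω).1).symm
      _ ≤ _ := by gcongr

lemma IsUnitEffect.isObservable_pair {u : V →ₗ[ℝ] ℝ} (hu : IsUnitEffect Ω u) {e : V →ₗ[ℝ] ℝ}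
    (he : IsEffect Ω e) : IsObservable Ω ![e, u - e] := by
  refine ⟨fun x w hw => ?_, fun w hw => ?_⟩
  · have h := he w hw
    fin_cases x
    · exact h
    · simpa [hu w hw, and_comm] using h
  · simp [Fin.sum_univ_two, hu w hw]

/-- If `Ω` spans a finite-dimensional space, some effect minimizes the discrimination error. -/
lemma exists_isEffect_error_min [FiniteDimensional ℝ V] (hspan : Submodule.span ℝ Ω = ⊤)
    (ω σ : V) :
    ∃ a : V →ₗ[ℝ] ℝ, IsEffect Ω a ∧
      ∀ c : V →ₗ[ℝ] ℝ, IsEffect Ω c → a σ + (1 - a ω) ≤ c σ + (1 - c ω) := by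
  classical
  let b := Module.Basis.ofSpan hspan.ge
  have hb (i) : b i ∈ Ω := Module.Basis.ofSpan_subset hspan.ge ⟨i, rfl⟩
  let := FiniteDimensional.fintypeBasisIndex b
  let L := b.constr ℝ (M' := ℝ)
  have hcont (v : V) : Continuous fun f => L f v := by
    simp only [L, Module.Basis.constr_apply_fintype]
    fun_prop
  have hK : IsCompact {f | IsEffect Ω (L f)} := by
    refine (isCompact_univ_pi fun _ => isCompact_Icc (a := (0 : ℝ)) (b := 1)).of_isClosed_subset
      ?_ fun f hf i _ => ?_
    · simp only [IsEffect, Set.ofPred_forall]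
      exact isClosed_biInter fun w _ => isClosed_Icc.preimage (hcont w)
    · simpa [L] using hf (b i) (hb i)
  obtain ⟨f, hf, hmin⟩ := hK.exists_isMinOn ⟨0, fun w _ => by simp⟩
    ((hcont σ).add (continuous_const.sub (hcont ω)) :
      Continuous fun f => L f σ + (1 - L f ω)).continuousOn
  refine ⟨L f, hf, fun c hc => ?_⟩
  have h := hmin (show L.symm c ∈ {f | IsEffect Ω (L f)} by simpa using hc)
  simpa using h

end Effects

/-- Fidelity equals `0` iff the two states are perfectly distinguishable, i.e. some effect
takes value `1` on one and `0` on the other. -/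
theorem fidelity_eq_zero_iff {V : Type*} [NormedAddCommGroup V] [NormedSpace ℝ V]
    [FiniteDimensional ℝ V] (Ω : Set V) (hΩ : IsStateSpace Ω)
    (ω σ : V) (hω : ω ∈ Ω) (hσ : σ ∈ Ω) :
    fidelity Ω ω σ = 0 ↔ ∃ e : V →ₗ[ℝ] ℝ, IsEffect Ω e ∧ e ω = 1 ∧ e σ = 0 := by
  obtain ⟨-, -, hspan, h0⟩ := hΩ
  obtain ⟨u, hu⟩ := exists_isUnitEffect h0 hω
  constructor
  · intro hF
    obtain ⟨a, ha, hmin⟩ := exists_isEffect_error_min hspan ω σ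
    have hle : a σ + (1 - a ω) ≤ fidelity Ω ω σ := by
      refine le_csInf ⟨_, 2, _, hu.isObservable_pair (e := 0) fun w _ => by simp, rfl⟩ ?_
      rintro _ ⟨n, e, he, rfl⟩
      obtain ⟨c, hc, hce⟩ := he.exists_isEffect_error_le hω hσ
      exact (hmin c hc).trans hce
    have h1 := (ha ω hω).2
    have h2 := (ha σ hσ).1
    exact ⟨a, ha, by linarith, by linarith⟩
  · rintro ⟨e, he, h1, h2⟩
    have hnonneg : ∀ r ∈ { r | ∃ (nn : ℕ) (e : Fin nn → (V →ₗ[ℝ] ℝ)), IsObservable Ω e ∧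
        r = ∑ x, Real.sqrt (e x ω) * Real.sqrt (e x σ) }, 0 ≤ r := by
      rintro _ ⟨n, e, -, rfl⟩
      positivity
    refine le_antisymm (csInf_le ⟨0, hnonneg⟩ ⟨2, _, hu.isObservable_pair he, ?_⟩)
      (Real.sInf_nonneg hnonneg)
    simp [Fin.sum_univ_two, h1, h2, hu ω hω]
end

section
/- (Theorem 1, no-programming theorem in GPTs) Let Ω_sys ⊆ V_sys and Ω_app ⊆ V_app be state spaces, Ω_tot a composite state space of Ω_sys and Ω_app, and Λ a reversible dynamics on Ω_tot. Let ξ, η be pure states of Ω_app implementing reversible dynamics α_ξ, α_η on Ω_sys through Λ, and assume: (a) for every pure state ω of Ω_sys there exist states ξ'(ω), η'(ω) ∈ Ω_app with Λ(ω ⊗ ξ) = α_ξ(ω) ⊗ ξ'(ω) and Λ(ω ⊗ η) = α_η(ω) ⊗ η'(ω); (b) the linear map α_ξ⁻¹ ⊗ id restricts to an affine bijection of Ω_tot onto itself. If α_ξ ≠ α_η, then ξ and η are perfectly distinguishable. -/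
open scoped BigOperators

/-- The tensor product of two states, realized in the function space indexed by the
product of the index sets. -/
def tmul {ι₁ ι₂ : Type} (ω : ι₁ → ℝ) (σ : ι₂ → ℝ) : ι₁ × ι₂ → ℝ :=
  fun p => ω p.1 * σ p.2

/-- Auxiliary: partial application of a functional on the second factor. -/
def curryMap {ι₁ ι₂ : Type} (f : (ι₂ → ℝ) →ₗ[ℝ] ℝ) : (ι₁ × ι₂ → ℝ) →ₗ[ℝ] (ι₁ → ℝ) where
  toFun μ := fun i => f (fun j => μ (i, j))
  map_add' μ ν := by funext i; exact f.map_add _ _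
  map_smul' c μ := by funext i; exact f.map_smul c _

/-- The tensor product `e ⊗ f` of two effects, as a linear functional on the
composite space; it satisfies `(e ⊗ f)(ω ⊗ σ) = e ω · f σ`. -/
def etmul {ι₁ ι₂ : Type} (e : (ι₁ → ℝ) →ₗ[ℝ] ℝ) (f : (ι₂ → ℝ) →ₗ[ℝ] ℝ) :
    (ι₁ × ι₂ → ℝ) →ₗ[ℝ] ℝ :=
  e.comp (curryMap f)

/-- The linear map `β ⊗ id` on the composite space. -/
def lTensorId {ι₁ ι₂ : Type} (β : (ι₁ → ℝ) →ₗ[ℝ] (ι₁ → ℝ)) :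
    (ι₁ × ι₂ → ℝ) →ₗ[ℝ] (ι₁ × ι₂ → ℝ) where
  toFun μ := fun p => β (fun i => μ (i, p.2)) p.1
  map_add' μ ν := by funext p; exact congrFun (β.map_add _ _) p.1
  map_smul' c μ := by funext p; exact congrFun (β.map_smul c _) p.1

/-- The minimal tensor product of two state spaces: the convex hull of product states. -/
def minTensor {ι₁ ι₂ : Type} (Ω₁ : Set (ι₁ → ℝ)) (Ω₂ : Set (ι₂ → ℝ)) :
    Set (ι₁ × ι₂ → ℝ) :=
  convexHull ℝ {μ | ∃ ω ∈ Ω₁, ∃ σ ∈ Ω₂, μ = tmul ω σ}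

/-- The maximal tensor product of two state spaces: all `μ` normalized by the unit effects
and giving nonnegative probabilities on all product effects. -/
def maxTensor {ι₁ ι₂ : Type} (Ω₁ : Set (ι₁ → ℝ)) (Ω₂ : Set (ι₂ → ℝ)) :
    Set (ι₁ × ι₂ → ℝ) :=
  {μ | (∀ u₁ u₂, IsUnitEffect Ω₁ u₁ → IsUnitEffect Ω₂ u₂ → etmul u₁ u₂ μ = 1) ∧
    ∀ e f, IsEffect Ω₁ e → IsEffect Ω₂ f → 0 ≤ etmul e f μ}

/-- A composite state space of `Ω₁` and `Ω₂`: a compact convex set between the minimal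
and the maximal tensor products. -/
def IsComposite {ι₁ ι₂ : Type} [Fintype ι₁] [Fintype ι₂] (Ω₁ : Set (ι₁ → ℝ))
    (Ω₂ : Set (ι₂ → ℝ)) (Ωtot : Set (ι₁ × ι₂ → ℝ)) : Prop :=
  IsCompact Ωtot ∧ Convex ℝ Ωtot ∧ minTensor Ω₁ Ω₂ ⊆ Ωtot ∧ Ωtot ⊆ maxTensor Ω₁ Ω₂

/-- A program `ξ ∈ Ω_app` implements the dynamics `α` on `Ω_sys` through the dynamics `Λ`
on the composite: `(e ⊗ u_app)(Λ(ω ⊗ ξ)) = e(α ω)` for all states `ω` and effects `e`. -/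
def Implements {ι₁ ι₂ : Type} (Ωsys : Set (ι₁ → ℝ)) (Ωapp : Set (ι₂ → ℝ))
    (Λ : (ι₁ × ι₂ → ℝ) →ₗ[ℝ] (ι₁ × ι₂ → ℝ)) (ξ : ι₂ → ℝ)
    (α : (ι₁ → ℝ) →ₗ[ℝ] (ι₁ → ℝ)) : Prop :=
  ∀ ω ∈ Ωsys, ∀ e : (ι₁ → ℝ) →ₗ[ℝ] ℝ, IsEffect Ωsys e →
    ∀ u₂ : (ι₂ → ℝ) →ₗ[ℝ] ℝ, IsUnitEffect Ωapp u₂ →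
      etmul e u₂ (Λ (tmul ω ξ)) = e (α ω)

section StateSpace

variable {V : Type*} [NormedAddCommGroup V] [NormedSpace ℝ V] {Ω : Set V}

lemma IsStateSpace.exists_isUnitEffect (hΩ : IsStateSpace Ω) :
    ∃ u : V →ₗ[ℝ] ℝ, IsUnitEffect Ω u := by
  obtain rfl | ⟨ω₀, hω₀⟩ := Ω.eq_empty_or_nonempty
  · exact ⟨0, by simp [IsUnitEffect]⟩
  have hnot : ω₀ ∉ vectorSpan ℝ Ω := fun h ↦ hΩ.2.2.2 <| by
    have := AffineSubspace.vadd_mem_of_mem_direction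
      (s := affineSpan ℝ Ω) (by rw [direction_affineSpan]; exact neg_mem h)
      (subset_affineSpan ℝ Ω hω₀)
    simpa using this
  obtain ⟨f, hf, hle⟩ := Submodule.exists_le_ker_of_notMem hnot
  refine ⟨(f ω₀)⁻¹ • f, fun ω hω ↦ ?_⟩
  have h : f (ω - ω₀) = 0 := hle (vsub_mem_vectorSpan ℝ hω hω₀)
  rw [map_sub, sub_eq_zero] at h
  simp [h, hf]

lemma IsUnitEffect.isEffect {u : V →ₗ[ℝ] ℝ} (hu : IsUnitEffect Ω u) : IsEffect Ω u :=
  fun ω hω ↦ by simp [hu ω hω]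

lemma IsEffect.unit_sub {u e : V →ₗ[ℝ] ℝ} (hu : IsUnitEffect Ω u) (he : IsEffect Ω e) :
    IsEffect Ω (u - e) := fun ω hω ↦ by
  have := he ω hω
  simp only [LinearMap.sub_apply, hu ω hω, Set.mem_Icc] at this ⊢
  constructor <;> linarith

lemma isObservable_unit {u : V →ₗ[ℝ] ℝ} (hu : IsUnitEffect Ω u) :
    IsObservable Ω (fun _ : Unit ↦ u) :=
  ⟨fun _ ↦ hu.isEffect, fun ω hω ↦ by simp [hu ω hω]⟩

lemma IsEffect.isObservable {u e : V →ₗ[ℝ] ℝ} (hu : IsUnitEffect Ω u) (he : IsEffect Ω e) :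
    IsObservable Ω ![e, u - e] := by
  refine ⟨fun x ↦ ?_, fun ω hω ↦ by simp [Fin.sum_univ_two, hu ω hω]⟩
  fin_cases x
  · exact he
  · exact he.unit_sub hu

lemma fidelity_le_of_isObservable {X : Type*} [Fintype X] {e : X → (V →ₗ[ℝ] ℝ)}
    (he : IsObservable Ω e) (ω σ : V) :
    fidelity Ω ω σ ≤ ∑ x, √(e x ω) * √(e x σ) := by
  refine csInf_le ⟨0, ?_⟩ ⟨Fintype.card X, e ∘ (Fintype.equivFin X).symm, ⟨fun x ↦ he.1 _, ?_⟩, ?_⟩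
  · rintro r ⟨n, f, -, rfl⟩
    positivity
  · intro τ hτ
    rw [← he.2 τ hτ]
    exact (Fintype.equivFin X).symm.sum_comp (fun x ↦ e x τ)
  · exact ((Fintype.equivFin X).symm.sum_comp (fun x ↦ √(e x ω) * √(e x σ))).symm

lemma fidelity_nonneg (Ω : Set V) (ω σ : V) : 0 ≤ fidelity Ω ω σ :=
  Real.sInf_nonneg <| by
    rintro r ⟨n, f, -, rfl⟩
    positivity

lemma IsStateSpace.exists_isObservable_lt (hΩ : IsStateSpace Ω) (ω σ : V) {t : ℝ}
    (ht : fidelity Ω ω σ < t) :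
    ∃ (n : ℕ) (e : Fin n → (V →ₗ[ℝ] ℝ)), IsObservable Ω e ∧
      ∑ x, √(e x ω) * √(e x σ) < t := by
  obtain ⟨u, hu⟩ := hΩ.exists_isUnitEffect
  obtain ⟨r, ⟨n, e, he, rfl⟩, hr⟩ := exists_lt_of_csInf_lt
    (s := {r | ∃ (nn : ℕ) (e : Fin nn → (V →ₗ[ℝ] ℝ)), IsObservable Ω e ∧
      r = ∑ x, √(e x ω) * √(e x σ)}) ⟨_, 1, fun _ ↦ u,
      ⟨fun _ ↦ hu.isEffect, fun ω hω ↦ by simp [hu ω hω]⟩, rfl⟩ ht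
  exact ⟨n, e, he, hr⟩

lemma le_mul_fidelity (hΩ : IsStateSpace Ω) (ω σ : V) {r c : ℝ} (hc : 0 ≤ c)
    (h : ∀ (n : ℕ) (e : Fin n → (V →ₗ[ℝ] ℝ)), IsObservable Ω e →
      r ≤ c * ∑ x, √(e x ω) * √(e x σ)) :
    r ≤ c * fidelity Ω ω σ := by
  by_contra! hlt
  obtain rfl | hc := hc.eq_or_lt
  · obtain ⟨n, e, he, -⟩ := hΩ.exists_isObservable_lt ω σ (lt_add_one _)
    have := h n e he
    linarith
  · obtain ⟨n, e, he, hr⟩ := hΩ.exists_isObservable_lt ω σ ((lt_div_iff₀' hc).2 hlt)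
    exact (h n e he).not_gt ((lt_div_iff₀' hc).1 hr)

lemma IsStateSpace.mem_of_extremePoints_subset (hΩ : IsStateSpace Ω) {s : Set V}
    (hs : IsClosed s) (hconv : Convex ℝ s) (h : Ω.extremePoints ℝ ⊆ s) : Ω ⊆ s := by
  rw [← closure_convexHull_extremePoints hΩ.1 hΩ.2.1]
  exact closure_minimal (convexHull_min h hconv) hs

variable [FiniteDimensional ℝ V]

lemma IsStateSpace.isEffect_of_extremePoints (hΩ : IsStateSpace Ω) {e : V →ₗ[ℝ] ℝ}
    (h : ∀ ω ∈ Ω.extremePoints ℝ, e ω ∈ Set.Icc (0 : ℝ) 1) : IsEffect Ω e :=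
  hΩ.mem_of_extremePoints_subset (s := e ⁻¹' Set.Icc 0 1)
    (isClosed_Icc.preimage e.continuous_of_finiteDimensional)
    ((convex_Icc 0 1).linear_preimage e) h

lemma IsStateSpace.span_extremePoints (hΩ : IsStateSpace Ω) :
    Submodule.span ℝ (Ω.extremePoints ℝ) = ⊤ := by
  rw [← top_le_iff, ← hΩ.2.2.1, Submodule.span_le]
  exact hΩ.mem_of_extremePoints_subset (Submodule.closed_of_finiteDimensional _)
    (Submodule.convex _) Submodule.subset_span


/-- Distinct states are separated by an effect. -/
lemma IsStateSpace.exists_effect_ne (hΩ : IsStateSpace Ω) {s t : V} (hs : s ∈ Ω) (ht : t ∈ Ω)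
    (hst : s ≠ t) : ∃ e : V →ₗ[ℝ] ℝ, IsEffect Ω e ∧ e s ≠ e t := by
  obtain ⟨u, hu⟩ := hΩ.exists_isUnitEffect
  obtain ⟨f, hf, -⟩ := Submodule.exists_le_ker_of_notMem (K := ℝ) (p := ⊥) (v := s - t)
    (by simpa [sub_eq_zero] using hst)
  obtain ⟨C, hC⟩ := hΩ.1.exists_bound_of_continuousOn
    (f.continuous_of_finiteDimensional.continuousOn (s := Ω))
  have hC₀ : 0 < |C| + 1 := by positivity
  refine ⟨(2⁻¹ : ℝ) • u + (2 * (|C| + 1))⁻¹ • f, fun ω hω ↦ ?_, fun h ↦ hf ?_⟩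
  · have h₁ : |f ω| ≤ |C| + 1 := ((hC ω hω).trans (le_abs_self C)).trans (by linarith)
    have h₂ : |(|C| + 1)⁻¹ * f ω| ≤ 1 := by
      rw [abs_mul, abs_inv, abs_of_pos hC₀]
      exact inv_mul_le_one_of_le₀ h₁ hC₀.le
    have h₃ := abs_le.1 h₂
    simp only [LinearMap.add_apply, LinearMap.smul_apply, smul_eq_mul, hu ω hω, mul_inv,
      mul_assoc, Set.mem_Icc]
    constructor <;> linarith
  · simpa [hu s hs, hu t ht, hC₀.ne', sub_eq_zero] using h

lemma sqrt_mul_sqrt_add_lt_one {a b : ℝ} (ha : a ∈ Set.Icc (0 : ℝ) 1)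
    (hb : b ∈ Set.Icc (0 : ℝ) 1) (hab : a ≠ b) : √a * √b + √(1 - a) * √(1 - b) < 1 := by
  have hne : √a - √b ≠ 0 := sub_ne_zero.2 fun h ↦ hab <| (Real.sqrt_inj ha.1 hb.1).1 h
  have h₁ := Real.sq_sqrt ha.1
  have h₂ := Real.sq_sqrt hb.1
  have h₃ := Real.sq_sqrt (sub_nonneg.2 ha.2)
  have h₄ := Real.sq_sqrt (sub_nonneg.2 hb.2)
  nlinarith [sq_pos_of_ne_zero hne, sq_nonneg (√(1 - a) - √(1 - b))]

lemma IsStateSpace.exists_isObservable_lt_one (hΩ : IsStateSpace Ω) {s t : V} (hs : s ∈ Ω)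
    (ht : t ∈ Ω) (hst : s ≠ t) :
    ∃ e : Fin 2 → (V →ₗ[ℝ] ℝ), IsObservable Ω e ∧ ∑ x, √(e x s) * √(e x t) < 1 := by
  obtain ⟨u, hu⟩ := hΩ.exists_isUnitEffect
  obtain ⟨e, he, hne⟩ := hΩ.exists_effect_ne hs ht hst
  refine ⟨_, he.isObservable hu, ?_⟩
  simpa [Fin.sum_univ_two, hu s hs, hu t ht] using
    sqrt_mul_sqrt_add_lt_one (he s hs) (he t ht) hne

/-- The effects on a state space form a compact set, so near-perfect distinguishability
implies perfect distinguishability. -/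
lemma IsStateSpace.exists_effect_of_forall_pos (hΩ : IsStateSpace Ω) {ω σ : V}
    (hω : ω ∈ Ω) (hσ : σ ∈ Ω)
    (h : ∀ ε > 0, ∃ e : V →ₗ[ℝ] ℝ, IsEffect Ω e ∧ 1 - e ω + e σ ≤ ε) :
    ∃ e : V →ₗ[ℝ] ℝ, IsEffect Ω e ∧ e ω = 1 ∧ e σ = 0 := by
  let b := Module.Basis.ofSpan hΩ.2.2.1.ge
  have hb : ∀ k, b k ∈ Ω := fun k ↦
    Module.Basis.ofSpan_subset hΩ.2.2.1.ge (Set.mem_range_self k)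
  have : Finite _ := Module.Finite.finite_basis b
  have := Fintype.ofFinite ↑(LinearIndepOn.extend (linearIndepOn_empty ℝ (id : V → V))
    (Set.empty_subset Ω))
  have hcont : ∀ v : V, Continuous fun c ↦ b.constr ℝ c v := fun v ↦
    ((LinearMap.applyₗ v).comp
      (b.constr ℝ (M' := ℝ)).toLinearMap).continuous_of_finiteDimensional
  have hK : IsCompact {c | IsEffect Ω (b.constr ℝ c)} := by
    refine (isCompact_univ_pi fun _ ↦ isCompact_Icc (a := (0 : ℝ)) (b := 1)).of_isClosed_subset
      ?_ fun c hc k _ ↦ by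
        simpa only [b.constr_basis] using hc _ (hb k)
    simp only [IsEffect, Set.ofPred_forall]
    exact isClosed_biInter fun v _ ↦ isClosed_Icc.preimage (hcont v)
  have hmem : ∀ e : V →ₗ[ℝ] ℝ, b.constr ℝ (e ∘ b) = e := fun e ↦ b.constr_self ℝ e
  obtain ⟨e₁, he₁, -⟩ := h 1 one_pos
  obtain ⟨c, hc, hmin⟩ := hK.exists_isMinOn ⟨e₁ ∘ b, by simpa [hmem] using he₁⟩
    (((continuous_const.sub (hcont ω)).add (hcont σ)).continuousOn
      (f := fun c ↦ 1 - b.constr ℝ c ω + b.constr ℝ c σ))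
  have hle : 1 - b.constr ℝ c ω + b.constr ℝ c σ ≤ 0 := le_of_forall_pos_le_add fun ε hε ↦ by
    obtain ⟨e, he, hε⟩ := h ε hε
    have := hmin (show IsEffect Ω (b.constr ℝ (e ∘ b)) by rwa [hmem])
    simp only [Set.mem_ofPred_eq, hmem] at this
    linarith
  have h₁ := (hc ω hω).2
  have h₂ := (hc σ hσ).1
  exact ⟨_, hc, by linarith, by linarith⟩

lemma IsStateSpace.exists_effect_of_fidelity_eq_zero (hΩ : IsStateSpace Ω) {ω σ : V}
    (hω : ω ∈ Ω) (hσ : σ ∈ Ω) (h : fidelity Ω ω σ = 0) :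
    ∃ e : V →ₗ[ℝ] ℝ, IsEffect Ω e ∧ e ω = 1 ∧ e σ = 0 := by
  classical
  refine hΩ.exists_effect_of_forall_pos hω hσ fun ε hε ↦ ?_
  obtain ⟨n, e, he, hlt⟩ := hΩ.exists_isObservable_lt ω σ (h.trans_lt hε)
  have hnn : ∀ τ ∈ Ω, ∀ x, 0 ≤ e x τ := fun τ hτ x ↦ (he.1 x τ hτ).1
  let p : Fin n → Prop := fun x ↦ e x σ ≤ e x ω
  refine ⟨∑ x with p x, e x, fun τ hτ ↦ ?_, ?_⟩
  · rw [LinearMap.sum_apply, ← he.2 τ hτ]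
    exact ⟨Finset.sum_nonneg fun x _ ↦ hnn τ hτ x,
      Finset.sum_le_sum_of_subset_of_nonneg (Finset.subset_univ _) fun x _ _ ↦ hnn τ hτ x⟩
  · refine le_trans ?_ hlt.le
    rw [LinearMap.sum_apply, LinearMap.sum_apply, ← he.2 ω hω,
      ← Finset.sum_filter_add_sum_filter_not Finset.univ p (fun x ↦ e x ω),
      ← Finset.sum_filter_add_sum_filter_not Finset.univ p (fun x ↦ √(e x ω) * √(e x σ)),
      add_sub_cancel_left, add_comm]
    refine add_le_add (Finset.sum_le_sum fun x hx ↦ ?_) (Finset.sum_le_sum fun x hx ↦ ?_)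
    · have hx : e x σ ≤ e x ω := (Finset.mem_filter.1 hx).2
      calc e x σ = √(e x σ) * √(e x σ) := (Real.mul_self_sqrt (hnn σ hσ x)).symm
        _ ≤ √(e x ω) * √(e x σ) := by gcongr
    · have hx : e x ω ≤ e x σ := (not_le.1 (Finset.mem_filter.1 hx).2).le
      calc e x ω = √(e x ω) * √(e x ω) := (Real.mul_self_sqrt (hnn ω hω x)).symm
        _ ≤ √(e x ω) * √(e x σ) := by gcongr

/-- A linear map permuting a spanning set is invertible. -/
lemma exists_linearEquiv_of_bijOn (hspan : Submodule.span ℝ Ω = ⊤) {f : V →ₗ[ℝ] V}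
    (hf : Set.BijOn f Ω Ω) : ∃ g : V ≃ₗ[ℝ] V, g.toLinearMap = f ∧ g '' Ω = Ω := by
  have hsurj : Function.Surjective f := by
    rw [← LinearMap.range_eq_top, ← top_le_iff, ← hspan, Submodule.span_le]
    exact fun v hv ↦ (hf.surjOn hv).imp fun _ h ↦ h.2
  exact ⟨.ofBijective f ⟨LinearMap.injective_iff_surjective.2 hsurj, hsurj⟩, rfl, hf.image_eq⟩

/-- If every pure state is an eigenvector of `T`, then pure states belonging to different
eigenvalues are perfectly distinguishable. -/
lemma IsStateSpace.exists_effect_of_eigenvalue_ne (hΩ : IsStateSpace Ω) {T : Module.End ℝ V}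
    {c : V → ℝ} (hT : ∀ ω ∈ Ω.extremePoints ℝ, T ω = c ω • ω) {ω σ : V}
    (hω : ω ∈ Ω.extremePoints ℝ) (hσ : σ ∈ Ω.extremePoints ℝ) (hne : c ω ≠ c σ) :
    ∃ e : V →ₗ[ℝ] ℝ, IsEffect Ω e ∧ e ω = 1 ∧ e σ = 0 := by
  obtain ⟨u, hu⟩ := hΩ.exists_isUnitEffect
  have hvec : ∀ τ ∈ Ω.extremePoints ℝ, T.HasEigenvector (c τ) τ := fun τ hτ ↦
    ⟨Module.End.mem_eigenspace_iff.2 (hT τ hτ), by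
      rintro rfl
      simpa using hu 0 hτ.1⟩
  let s := (Module.End.finite_hasEigenvalue T).toFinset
  have hs : ∀ τ ∈ Ω.extremePoints ℝ, c τ ∈ s := fun τ hτ ↦ by
    simpa [s] using Module.End.hasEigenvalue_of_hasEigenvector (hvec τ hτ)
  let p := Lagrange.basis s id (c ω)
  have hval : ∀ τ ∈ Ω.extremePoints ℝ,
      (u ∘ₗ Polynomial.aeval T p) τ = p.eval (c τ) := fun τ hτ ↦ by
    rw [LinearMap.comp_apply, Module.End.aeval_apply_of_hasEigenvector (hvec τ hτ), map_smul,
      hu τ hτ.1, smul_eq_mul, mul_one]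
  have h₁ : p.eval (c ω) = 1 :=
    Lagrange.eval_basis_self (v := id) Function.injective_id.injOn (hs ω hω)
  have h₀ : ∀ τ ∈ Ω.extremePoints ℝ, c ω ≠ c τ → p.eval (c τ) = 0 := fun τ hτ h ↦
    Lagrange.eval_basis_of_ne (v := id) h (hs τ hτ)
  refine ⟨u ∘ₗ Polynomial.aeval T p, hΩ.isEffect_of_extremePoints fun τ hτ ↦ ?_, ?_, ?_⟩
  · rw [hval τ hτ]
    by_cases h : c ω = c τ
    · simp [← h, h₁]
    · simp [h₀ τ hτ h]
  · rw [hval ω hω, h₁]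
  · rw [hval σ hσ, h₀ σ hσ hne]

end StateSpace

section Tensor

variable {ι₁ ι₂ : Type}

lemma curryMap_tmul (f : (ι₂ → ℝ) →ₗ[ℝ] ℝ) (ω : ι₁ → ℝ) (σ : ι₂ → ℝ) :
    curryMap f (tmul ω σ) = f σ • ω := funext fun i ↦ by
  change f (ω i • σ) = _
  simp [mul_comm]

lemma etmul_tmul (e : (ι₁ → ℝ) →ₗ[ℝ] ℝ) (f : (ι₂ → ℝ) →ₗ[ℝ] ℝ) (ω : ι₁ → ℝ) (σ : ι₂ → ℝ) :
    etmul e f (tmul ω σ) = e ω * f σ := by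
  simp [etmul, curryMap_tmul, mul_comm]

lemma etmul_sum {X Y : Type*} [Fintype X] [Fintype Y] (e : X → ((ι₁ → ℝ) →ₗ[ℝ] ℝ))
    (f : Y → ((ι₂ → ℝ) →ₗ[ℝ] ℝ)) (μ : ι₁ × ι₂ → ℝ) :
    etmul (∑ x, e x) (∑ y, f y) μ = ∑ z : X × Y, etmul (e z.1) (f z.2) μ := by
  have h : curryMap (∑ y, f y) μ = ∑ y, curryMap (f y) μ := by
    ext i
    simp [curryMap]
  simp [etmul, h, Fintype.sum_prod_type]

/-- The tensor product of states as a bilinear map. -/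
def tmulBilin (ι₁ ι₂ : Type) : (ι₁ → ℝ) →ₗ[ℝ] (ι₂ → ℝ) →ₗ[ℝ] (ι₁ × ι₂ → ℝ) :=
  LinearMap.mk₂ ℝ tmul (fun _ _ _ ↦ funext fun _ ↦ add_mul _ _ _)
    (fun _ _ _ ↦ funext fun _ ↦ mul_assoc _ _ _) (fun _ _ _ ↦ funext fun _ ↦ mul_add _ _ _)
    (fun _ _ _ ↦ funext fun _ ↦ mul_left_comm _ _ _)

@[simp]
lemma tmulBilin_apply (ω : ι₁ → ℝ) (σ : ι₂ → ℝ) : tmulBilin ι₁ ι₂ ω σ = tmul ω σ := rfl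

variable [Fintype ι₁] [Fintype ι₂] {Ωsys : Set (ι₁ → ℝ)} {Ωapp : Set (ι₂ → ℝ)}
  {Ωtot : Set (ι₁ × ι₂ → ℝ)}

lemma IsComposite.tmul_mem (htot : IsComposite Ωsys Ωapp Ωtot) {ω : ι₁ → ℝ} {σ : ι₂ → ℝ}
    (hω : ω ∈ Ωsys) (hσ : σ ∈ Ωapp) : tmul ω σ ∈ Ωtot :=
  htot.2.2.1 (subset_convexHull ℝ _ ⟨ω, hω, σ, hσ, rfl⟩)

lemma IsComposite.span_eq_top (htot : IsComposite Ωsys Ωapp Ωtot)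
    (hsys : Submodule.span ℝ Ωsys = ⊤) (happ : Submodule.span ℝ Ωapp = ⊤) :
    Submodule.span ℝ Ωtot = ⊤ := by
  classical
  have hle : Submodule.map₂ (tmulBilin ι₁ ι₂) ⊤ ⊤ ≤ Submodule.span ℝ Ωtot := by
    rw [← hsys, ← happ, Submodule.map₂_span_span]
    refine Submodule.span_mono ?_
    rintro _ ⟨ω, hω, σ, hσ, rfl⟩
    exact htot.tmul_mem hω hσ
  rw [← top_le_iff, ← (Pi.basisFun ℝ (ι₁ × ι₂)).span_eq, Submodule.span_le]
  rintro _ ⟨⟨i, j⟩, rfl⟩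
  refine hle ?_
  convert Submodule.apply_mem_map₂ (tmulBilin ι₁ ι₂) (Submodule.mem_top (x := Pi.single i 1))
    (Submodule.mem_top (x := Pi.single j 1)) using 1
  ext ⟨i', j'⟩
  simp [tmul, Pi.single_apply, ← ite_and, and_comm]

lemma IsComposite.isObservable_etmul (htot : IsComposite Ωsys Ωapp Ωtot) {X Y : Type*}
    [Fintype X] [Fintype Y] {e : X → ((ι₁ → ℝ) →ₗ[ℝ] ℝ)} {f : Y → ((ι₂ → ℝ) →ₗ[ℝ] ℝ)}
    (he : IsObservable Ωsys e) (hf : IsObservable Ωapp f) :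
    IsObservable Ωtot (fun z : X × Y ↦ etmul (e z.1) (f z.2)) := by
  have hnn : ∀ μ ∈ Ωtot, ∀ z : X × Y, 0 ≤ etmul (e z.1) (f z.2) μ := fun μ hμ z ↦
    (htot.2.2.2 hμ).2 _ _ (he.1 _) (hf.1 _)
  have hsum : ∀ μ ∈ Ωtot, ∑ z : X × Y, etmul (e z.1) (f z.2) μ = 1 := fun μ hμ ↦ by
    rw [← etmul_sum]
    exact (htot.2.2.2 hμ).1 _ _ (fun ω hω ↦ by simpa using he.2 ω hω)
      fun σ hσ ↦ by simpa using hf.2 σ hσ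
  refine ⟨fun z μ hμ ↦ ⟨hnn μ hμ z, ?_⟩, hsum⟩
  rw [← hsum μ hμ]
  exact Finset.single_le_sum (f := fun z : X × Y ↦ etmul (e z.1) (f z.2) μ)
    (fun z _ ↦ hnn μ hμ z) (Finset.mem_univ z)

lemma IsObservable.comp {V W : Type*} [AddCommGroup V] [Module ℝ V] [AddCommGroup W]
    [Module ℝ W] {Ω : Set V} {Ω' : Set W} {X : Type*} [Fintype X] {e : X → (W →ₗ[ℝ] ℝ)}
    (he : IsObservable Ω' e) {M : V →ₗ[ℝ] W} (hM : Set.MapsTo M Ω Ω') :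
    IsObservable Ω (fun x ↦ e x ∘ₗ M) :=
  ⟨fun x _ hω ↦ he.1 x _ (hM hω), fun _ hω ↦ he.2 _ (hM hω)⟩

/-- A linear map sending the states of `Ωapp` to composite states, and two given states to
product states, bounds the fidelity of the given states by that of the factors. -/
lemma IsComposite.fidelity_le_mul (htot : IsComposite Ωsys Ωapp Ωtot) (happ : IsStateSpace Ωapp)
    {M : (ι₂ → ℝ) →ₗ[ℝ] (ι₁ × ι₂ → ℝ)} (hM : Set.MapsTo M Ωapp Ωtot) {s t : ι₁ → ℝ}
    {p q p' q' : ι₂ → ℝ} (hs : s ∈ Ωsys) (ht : t ∈ Ωsys) (hp : M p = tmul s p')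
    (hq : M q = tmul t q') {X : Type*} [Fintype X] {e : X → ((ι₁ → ℝ) →ₗ[ℝ] ℝ)}
    (he : IsObservable Ωsys e) :
    fidelity Ωapp p q ≤ (∑ x, √(e x s) * √(e x t)) * fidelity Ωapp p' q' := by
  refine le_mul_fidelity happ _ _ (by positivity) fun n f hf ↦ ?_
  refine (fidelity_le_of_isObservable ((htot.isObservable_etmul he hf).comp hM) p q).trans_eq ?_
  rw [Finset.sum_mul_sum, Fintype.sum_prod_type]
  refine Finset.sum_congr rfl fun x _ ↦ Finset.sum_congr rfl fun y _ ↦ ?_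
  simp only [LinearMap.comp_apply, hp, hq, etmul_tmul, Real.sqrt_mul (he.1 x _ hs).1,
    Real.sqrt_mul (he.1 x _ ht).1]
  ring

end Tensor

/-- Theorem 1 (no-programming theorem in GPTs): if pure programs `ξ, η` implement
reversible dynamics `αξ, αη` on the system through a reversible dynamics `Λ` of the
composite, each sending pure system states to product states, `αξ⁻¹ ⊗ id` restricting
to an affine bijection of the composite state space, and `αξ ≠ αη`, then `ξ` and `η`
are perfectly distinguishable. -/
theorem no_programming_GPT {ι₁ ι₂ : Type} [Fintype ι₁] [Fintype ι₂]
    (Ωsys : Set (ι₁ → ℝ)) (Ωapp : Set (ι₂ → ℝ)) (Ωtot : Set (ι₁ × ι₂ → ℝ))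
    (hsys : IsStateSpace Ωsys) (happ : IsStateSpace Ωapp)
    (htot : IsComposite Ωsys Ωapp Ωtot)
    (Λ : (ι₁ × ι₂ → ℝ) →ₗ[ℝ] (ι₁ × ι₂ → ℝ)) (hΛ : Set.BijOn Λ Ωtot Ωtot)
    (ξ η : ι₂ → ℝ) (hξ : ξ ∈ Ωapp.extremePoints ℝ) (hη : η ∈ Ωapp.extremePoints ℝ)
    (αξ αη : (ι₁ → ℝ) →ₗ[ℝ] (ι₁ → ℝ))
    (hαξ : Set.BijOn αξ Ωsys Ωsys) (hαη : Set.BijOn αη Ωsys Ωsys)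
    (himpξ : Implements Ωsys Ωapp Λ ξ αξ) (himpη : Implements Ωsys Ωapp Λ η αη)
    (ha : ∀ ω ∈ Ωsys.extremePoints ℝ,
      (∃ ξ' ∈ Ωapp, Λ (tmul ω ξ) = tmul (αξ ω) ξ') ∧
      (∃ η' ∈ Ωapp, Λ (tmul ω η) = tmul (αη ω) η'))
    (hb : ∃ β : (ι₁ → ℝ) →ₗ[ℝ] (ι₁ → ℝ), (∀ v, β (αξ v) = v) ∧ (∀ v, αξ (β v) = v) ∧
      Set.BijOn (lTensorId β) Ωtot Ωtot)
    (hdist : αξ ≠ αη) :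
    ∃ e : (ι₂ → ℝ) →ₗ[ℝ] ℝ, IsEffect Ωapp e ∧ e ξ = 1 ∧ e η = 0 := by
  obtain ⟨A, rfl, hA⟩ := exists_linearEquiv_of_bijOn hsys.2.2.1 hαξ
  obtain ⟨B, rfl, hB⟩ := exists_linearEquiv_of_bijOn hsys.2.2.1 hαη
  obtain ⟨L, rfl, hL⟩ := exists_linearEquiv_of_bijOn
    (htot.span_eq_top hsys.2.2.1 happ.2.2.1) hΛ
  simp only [LinearEquiv.coe_coe] at hαξ hαη hΛ ha
  obtain ⟨u, hu⟩ := happ.exists_isUnitEffect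
  obtain ⟨v, hv⟩ := hsys.exists_isUnitEffect
  obtain ⟨σ, hσ, hne⟩ : ∃ σ ∈ Ωsys.extremePoints ℝ, A σ ≠ B σ := by
    by_contra! h
    exact hdist (LinearMap.ext_on hsys.span_extremePoints h)
  have hAsymm : Set.MapsTo A.symm Ωsys Ωsys := fun ω hω ↦ by
    obtain ⟨ω, hω', rfl⟩ := hA.ge hω
    simpa using hω'
  have hτ : A.symm (B σ) ∈ Ωsys.extremePoints ℝ := by
    have h₁ := image_extremePoints A Ωsys
    have h₂ := image_extremePoints B Ωsys
    rw [hA] at h₁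
    rw [hB] at h₂
    obtain ⟨τ, hτ, h⟩ := h₁.ge (h₂.le ⟨σ, hσ, rfl⟩)
    simpa [← h] using hτ
  set τ := A.symm (B σ) with hτdef
  have hAτ : A τ = B σ := A.apply_symm_apply _
  have hmaps : ∀ ω ∈ Ωsys, Set.MapsTo (tmulBilin ι₁ ι₂ ω) Ωapp Ωtot :=
    fun ω hω p hp ↦ htot.tmul_mem hω hp
  choose! ξ' hξ'mem hξ' using fun ω hω ↦ (ha ω hω).1
  obtain ⟨η', -, hη'⟩ := (ha σ hσ).2
  by_cases hprog : ξ' σ = ξ' τ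
  · have hMapp : Set.MapsTo (L.toLinearMap ∘ₗ tmulBilin ι₁ ι₂ σ) Ωapp Ωtot :=
      hΛ.mapsTo.comp (hmaps σ hσ.1)
    have hMsymm : Set.MapsTo (L.symm.toLinearMap ∘ₗ tmulBilin ι₁ ι₂ (B σ)) Ωapp Ωtot :=
      fun p hp ↦ by
        obtain ⟨μ, hμ, h⟩ := hL.ge (hmaps _ (hαη.mapsTo hσ.1) hp)
        simpa [← h] using hμ
    obtain ⟨e, he, hlt⟩ := hsys.exists_isObservable_lt_one (hαξ.mapsTo hσ.1)
      (hαη.mapsTo hσ.1) hne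
    have h₁ : fidelity Ωapp ξ η ≤ _ * fidelity Ωapp (ξ' τ) η' :=
      htot.fidelity_le_mul happ hMapp (hαξ.mapsTo hσ.1) (hαη.mapsTo hσ.1)
        (by simpa [← hprog] using hξ' σ hσ) (by simpa using hη') he
    have h₂ : fidelity Ωapp (ξ' τ) η' ≤ _ * fidelity Ωapp ξ η :=
      htot.fidelity_le_mul happ hMsymm hτ.1 hσ.1
        (by simp [L.symm_apply_eq, ← hAτ, hξ' τ hτ]) (by simp [L.symm_apply_eq, hη'])
        (isObservable_unit hv)
    have h₃ := fidelity_nonneg Ωapp ξ η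
    simp only [Finset.univ_unique, Finset.sum_const, Finset.card_singleton, one_smul,
      hv τ hτ.1, hv σ hσ.1, Real.sqrt_one, one_mul] at h₂
    have h₄ : 0 ≤ ∑ x, √(e x (A σ)) * √(e x (B σ)) := by positivity
    have h₅ := h₁.trans (mul_le_mul_of_nonneg_left h₂ h₄)
    exact happ.exists_effect_of_fidelity_eq_zero hξ.1 hη.1 (by nlinarith)
  · obtain ⟨j, hj⟩ := Function.ne_iff.1 hprog
    obtain ⟨e, he, he₁, he₀⟩ := hsys.exists_effect_of_eigenvalue_ne
      (T := A.symm.toLinearMap ∘ₗ curryMap (LinearMap.proj j) ∘ₗ L.toLinearMap ∘ₗ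
        (tmulBilin ι₁ ι₂).flip ξ) (c := fun ω ↦ ξ' ω j)
      (fun ω hω ↦ by simp [hξ' ω hω, curryMap_tmul]) hσ hτ hj
    have heA : IsEffect Ωsys (e ∘ₗ A.symm.toLinearMap) := fun ω hω ↦ he _ (hAsymm hω)
    refine ⟨etmul (e ∘ₗ A.symm.toLinearMap) u ∘ₗ L.toLinearMap ∘ₗ tmulBilin ι₁ ι₂ σ,
      fun p hp ↦ ?_, ?_, ?_⟩
    · exact (htot.isObservable_etmul (heA.isObservable hv) (isObservable_unit hu)).1 (0, ())
        _ (hΛ.mapsTo (hmaps σ hσ.1 hp))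
    · simp [hξ' σ hσ, etmul_tmul, he₁, hu _ (hξ'mem σ hσ)]
    · simp [hη', etmul_tmul, ← hτdef, he₀]
end
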